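/- arXiv:1702.07466 — 4 statements merged into one kernel-verified Lean document; each statement's English description precedes it below -/
import Mathlib

section
/- In the Jacobson algebra J over a field k, the two-sided ideal generated by the idempotent p = 1 − x·y equals the k-linear span of the set { e_{i,j} = x^i · p · y^j : i, j ∈ ℕ }. -/
/-- The defining relation of the Jacobson algebra: `y * x = 1`, where
`x` is the image of the generator `0` and `y` the image of the generator `1`
of the free associative unital algebra on two generators. -/
inductive JacobsonRel (k : Type) [Field k] :
    FreeAlgebra k (Fin 2) → FreeAlgebra k (Fin 2) → Prop
  | rel : JacobsonRel k (FreeAlgebra.ι k 1 * FreeAlgebra.ι k 0) 1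

/-- The Jacobson algebra over `k`. -/
abbrev Jacobson (k : Type) [Field k] := RingQuot (JacobsonRel k)

/-- The image of the generator `x` in the Jacobson algebra. -/
noncomputable def Jx (k : Type) [Field k] : Jacobson k :=
  RingQuot.mkAlgHom k (JacobsonRel k) (FreeAlgebra.ι k 0)

/-- The image of the generator `y` in the Jacobson algebra. -/
noncomputable def Jy (k : Type) [Field k] : Jacobson k :=
  RingQuot.mkAlgHom k (JacobsonRel k) (FreeAlgebra.ι k 1)

namespace Submodule

variable {R A : Type*} [CommSemiring R] [Semiring A] [Algebra R A] {s : Set A}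

theorem mul_mem_of_adjoin_eq_top_left (hs : Algebra.adjoin R s = ⊤) {M : Submodule R A}
    (hM : ∀ a ∈ s, ∀ m ∈ M, a * m ∈ M) (a : A) {m : A} (hm : m ∈ M) : a * m ∈ M := by
  have ha : a ∈ Algebra.adjoin R s := hs ▸ Algebra.mem_top
  induction ha using Algebra.adjoin_induction generalizing m with
  | mem a ha => exact hM a ha m hm
  | algebraMap r => rw [← Algebra.smul_def]; exact M.smul_mem r hm
  | add a b _ _ iha ihb => rw [add_mul]; exact M.add_mem (iha hm) (ihb hm)
  | mul a b _ _ iha ihb => rw [mul_assoc]; exact iha (ihb hm)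

theorem mul_mem_of_adjoin_eq_top_right (hs : Algebra.adjoin R s = ⊤) {M : Submodule R A}
    (hM : ∀ a ∈ s, ∀ m ∈ M, m * a ∈ M) (a : A) {m : A} (hm : m ∈ M) : m * a ∈ M := by
  have ha : a ∈ Algebra.adjoin R s := hs ▸ Algebra.mem_top
  induction ha using Algebra.adjoin_induction generalizing m with
  | mem a ha => exact hM a ha m hm
  | algebraMap r => rw [← Algebra.commutes, ← Algebra.smul_def]; exact M.smul_mem r hm
  | add a b _ _ iha ihb => rw [mul_add]; exact M.add_mem (iha hm) (ihb hm)
  | mul a b _ _ iha ihb => rw [← mul_assoc]; exact ihb (iha hm)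

end Submodule

section MatrixUnits

variable {R A : Type*} [CommRing R] [Ring A] [Algebra R A] {x y : A}

theorem mul_mem_span_matrix_units_left (h : y * x = 1) :
    ∀ a ∈ ({x, y} : Set A),
      ∀ m ∈ Submodule.span R (Set.range fun n : ℕ × ℕ => x ^ n.1 * (1 - x * y) * y ^ n.2),
        a * m ∈ Submodule.span R
          (Set.range fun n : ℕ × ℕ => x ^ n.1 * (1 - x * y) * y ^ n.2) := by
  intro a ha m hm
  induction hm using Submodule.span_induction with
  | zero => rw [mul_zero]; exact Submodule.zero_mem _
  | add u v _ _ hu hv => rw [mul_add]; exact Submodule.add_mem _ hu hv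
  | smul r u _ hu => rw [mul_smul_comm]; exact Submodule.smul_mem _ r hu
  | mem u hu =>
    obtain ⟨⟨i, j⟩, rfl⟩ := hu
    obtain rfl | rfl := ha
    · exact Submodule.subset_span ⟨(i + 1, j), by simp only [pow_succ', mul_assoc]⟩
    · cases i with
      | zero =>
        have hp : a * (1 - x * a) = 0 := by rw [mul_sub, ← mul_assoc, h, mul_one, one_mul, sub_self]
        simp only [pow_zero, one_mul, ← mul_assoc, hp, zero_mul]
        exact Submodule.zero_mem _
      | succ i =>
        refine Submodule.subset_span ⟨(i, j), ?_⟩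
        simp only [pow_succ', ← mul_assoc, h, one_mul]

theorem mul_mem_span_matrix_units_right (h : y * x = 1) :
    ∀ a ∈ ({x, y} : Set A),
      ∀ m ∈ Submodule.span R (Set.range fun n : ℕ × ℕ => x ^ n.1 * (1 - x * y) * y ^ n.2),
        m * a ∈ Submodule.span R
          (Set.range fun n : ℕ × ℕ => x ^ n.1 * (1 - x * y) * y ^ n.2) := by
  intro a ha m hm
  induction hm using Submodule.span_induction with
  | zero => rw [zero_mul]; exact Submodule.zero_mem _
  | add u v _ _ hu hv => rw [add_mul]; exact Submodule.add_mem _ hu hv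
  | smul r u _ hu => rw [smul_mul_assoc]; exact Submodule.smul_mem _ r hu
  | mem u hu =>
    obtain ⟨⟨i, j⟩, rfl⟩ := hu
    obtain rfl | rfl := ha
    · cases j with
      | zero =>
        have hp : (1 - a * y) * a = 0 := by rw [sub_mul, mul_assoc, h, mul_one, one_mul, sub_self]
        simp only [pow_zero, mul_one, mul_assoc, hp, mul_zero]
        exact Submodule.zero_mem _
      | succ j =>
        refine Submodule.subset_span ⟨(i, j), ?_⟩
        simp only [pow_succ, mul_assoc, h, mul_one]
    · exact Submodule.subset_span ⟨(i, j + 1), by simp only [pow_succ, mul_assoc]⟩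

theorem TwoSidedIdeal.coe_span_one_sub_mul_eq_span_matrix_units (h : y * x = 1)
    (hxy : Algebra.adjoin R {x, y} = ⊤) :
    (TwoSidedIdeal.span {1 - x * y} : Set A) =
      (Submodule.span R (Set.range fun n : ℕ × ℕ => x ^ n.1 * (1 - x * y) * y ^ n.2) : Set A) := by
  apply Set.Subset.antisymm
  · intro z hz
    induction hz using TwoSidedIdeal.span_induction with
    | mem z hz =>
      rw [Set.mem_singleton_iff.mp hz]
      exact Submodule.subset_span ⟨(0, 0), by simp⟩
    | zero => exact Submodule.zero_mem _
    | add u v _ _ hu hv => exact Submodule.add_mem _ hu hv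
    | neg u _ hu => exact Submodule.neg_mem _ hu
    | left_absorb a u _ hu =>
      exact Submodule.mul_mem_of_adjoin_eq_top_left hxy (mul_mem_span_matrix_units_left h) a hu
    | right_absorb b u _ hu =>
      exact Submodule.mul_mem_of_adjoin_eq_top_right hxy (mul_mem_span_matrix_units_right h) b hu
  · intro z hz
    induction hz using Submodule.span_induction with
    | mem z hz =>
      obtain ⟨⟨i, j⟩, rfl⟩ := hz
      exact TwoSidedIdeal.mul_mem_right _ _ _
        (TwoSidedIdeal.mul_mem_left _ _ _ (TwoSidedIdeal.subset_span rfl))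
    | zero => exact TwoSidedIdeal.zero_mem _
    | add u v _ _ hu hv => exact TwoSidedIdeal.add_mem _ hu hv
    | smul r u _ hu => rw [Algebra.smul_def]; exact TwoSidedIdeal.mul_mem_left _ _ _ hu

end MatrixUnits

theorem Jy_mul_Jx (k : Type) [Field k] : Jy k * Jx k = 1 := by
  rw [Jx, Jy, ← map_mul, RingQuot.mkAlgHom_rel k JacobsonRel.rel, map_one]

theorem adjoin_Jx_Jy (k : Type) [Field k] : Algebra.adjoin k {Jx k, Jy k} = ⊤ := by
  have hrange : ({Jx k, Jy k} : Set (Jacobson k)) =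
      RingQuot.mkAlgHom k (JacobsonRel k) '' Set.range (FreeAlgebra.ι k) := by
    ext z
    simp [Jx, Jy, Fin.exists_fin_two, eq_comm]
  rw [hrange, ← AlgHom.map_adjoin, FreeAlgebra.adjoin_range_ι, Algebra.map_top,
    AlgHom.range_eq_top]
  exact RingQuot.mkAlgHom_surjective k _

/-- In the Jacobson algebra, the two-sided ideal generated by the idempotent
`p = 1 - x*y` coincides, as a set, with the `k`-linear span of the elements
`e i j = x^i * p * y^j`. -/
theorem jacobson_ideal_of_p_eq_span_matrix_units (k : Type) [Field k] :
    (TwoSidedIdeal.span {1 - Jx k * Jy k} : Set (Jacobson k)) =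
      (Submodule.span k (Set.range fun p : ℕ × ℕ =>
        Jx k ^ p.1 * (1 - Jx k * Jy k) * Jy k ^ p.2) : Set (Jacobson k)) :=
  TwoSidedIdeal.coe_span_one_sub_mul_eq_span_matrix_units (Jy_mul_Jx k) (adjoin_Jx_Jy k)
end

section
/- Let A be a unital associative k-algebra and e ∈ A a nonzero idempotent such that eAe = k·e (the corner eAe is one-dimensional, spanned by e). Suppose 1 − e = b_1·c_1 + ⋯ + b_n·c_n with b_i ∈ (1−e)Ae and c_i ∈ eA(1−e), and suppose n is minimal among all such presentations (there is no such presentation of 1 − e with fewer than n terms). Then c_i · b_j = e if i = j and c_i · b_j = 0 if i ≠ j, for all 1 ≤ i, j ≤ n. -/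
open scoped BigOperators

/-- In a presentation `x = ∑ i, b i * c i` with the fewest terms, where the `c i` range over a
subspace `V`, the elements `b i` are linearly independent. -/
theorem linearIndependent_of_minimal_presentation {k A : Type*} [Field k] [Ring A] [Algebra k A]
    (U : Set A) (V : Submodule k A) (x : A) {n : ℕ} (b c : Fin n → A)
    (hb : ∀ i, b i ∈ U) (hc : ∀ i, c i ∈ V) (hsum : ∑ i, b i * c i = x)
    (hmin : ∀ (m : ℕ) (b' c' : Fin m → A), (∀ i, b' i ∈ U) → (∀ i, c' i ∈ V) →
      ∑ i, b' i * c' i = x → n ≤ m) :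
    LinearIndependent k b := by
  rw [Fintype.linearIndependent_iff]
  intro g hg p
  by_contra hp
  obtain _ | m := n
  · exact p.elim0
  let c' : Fin (m + 1) → A := fun i => c i - ((g p)⁻¹ * g i) • c p
  have hc'p : c' p = 0 := by simp [c', inv_mul_cancel₀ hp]
  have hsum' : ∑ i, b i * c' i = x := by
    have h : ∑ i, b i * (((g p)⁻¹ * g i) • c p) = (g p)⁻¹ • ((∑ i, g i • b i) * c p) := by
      simp [Finset.sum_mul, Finset.smul_sum, mul_smul]
    simp only [c', mul_sub, Finset.sum_sub_distrib, hsum, h, hg, zero_mul, smul_zero, sub_zero]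
  rw [Fin.sum_univ_succAbove _ p, hc'p, mul_zero, zero_add] at hsum'
  have := hmin m (fun i => b (p.succAbove i)) (fun i => c' (p.succAbove i))
    (fun i => hb _) (fun i => V.sub_mem (hc _) (V.smul_mem _ (hc _))) hsum'
  omega

/-- Let `A` be a unital associative `k`-algebra with a nonzero idempotent `e` whose
corner `eAe` is spanned by `e` over `k`.  If `1 - e = ∑ i, b i * c i` with
`b i ∈ (1-e)Ae`, `c i ∈ eA(1-e)`, and the number `n` of terms is minimal among all
such presentations, then `c i * b j = e` if `i = j` and `c i * b j = 0` otherwise. -/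
theorem minimal_presentation_orthogonality (k : Type) [Field k]
    (A : Type) [Ring A] [Algebra k A]
    (e : A) (he : e * e = e) (he0 : e ≠ 0)
    (hcorner : ∀ a : A, ∃ c : k, e * a * e = c • e)
    (n : ℕ) (b c : Fin n → A)
    (hb : ∀ i, (1 - e) * b i * e = b i)
    (hc : ∀ i, e * c i * (1 - e) = c i)
    (hsum : ∑ i, b i * c i = 1 - e)
    (hmin : ∀ (m : ℕ) (b' c' : Fin m → A),
      (∀ i, (1 - e) * b' i * e = b' i) →
      (∀ i, e * c' i * (1 - e) = c' i) →
      (∑ i, b' i * c' i = 1 - e) → n ≤ m) :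
    ∀ i j, c i * b j = if i = j then e else 0 := by
  let V : Submodule k A :=
    LinearMap.eqLocus (LinearMap.mulLeft k e ∘ₗ LinearMap.mulRight k (1 - e)) LinearMap.id
  have hV : ∀ x, x ∈ V ↔ e * x * (1 - e) = x := fun x => by
    simp [V, LinearMap.mem_eqLocus, mul_assoc]
  have hli : LinearIndependent k b :=
    linearIndependent_of_minimal_presentation {x | (1 - e) * x * e = x} V (1 - e) b c hb
      (fun i => (hV _).2 (hc i)) hsum
      fun m b' c' hb' hc' => hmin m b' c' hb' fun i => (hV _).1 (hc' i)
  have hee : (1 - e) * (1 - e) = 1 - e := by simp [mul_sub, sub_mul, he]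
  have hbe : ∀ i, b i * e = b i := fun i => by
    rw [← hb i, mul_assoc, he]
  have heb : ∀ i, (1 - e) * b i = b i := fun i => by
    rw [← hb i, ← mul_assoc, ← mul_assoc, hee]
  have hec : ∀ i, e * c i = c i := fun i => by
    rw [← hc i, ← mul_assoc, ← mul_assoc, he]
  have hcb : ∀ i j, ∃ t : k, c i * b j = t • e := fun i j => by
    obtain ⟨t, ht⟩ := hcorner (c i * b j)
    exact ⟨t, by rw [← ht, ← mul_assoc, hec, mul_assoc, hbe]⟩
  choose γ hγ using hcb
  intro i j
  have hrel : ∑ l, (γ l j - if l = j then 1 else 0) • b l = 0 := by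
    have h : ∑ l, γ l j • b l = b j := by
      calc ∑ l, γ l j • b l = (∑ l, b l * c l) * b j := by
            simp [Finset.sum_mul, mul_assoc, hγ, hbe]
        _ = b j := by rw [hsum, heb]
    simp [sub_smul, Finset.sum_sub_distrib, h]
  have hij := sub_eq_zero.1 (Fintype.linearIndependent_iff.1 hli _ hrel i)
  rw [hγ, hij]
  split_ifs <;> simp
end

section
/- Let C be a monoidal category that is preadditive with bilinear tensor product on morphisms (monoidal preadditive) and has binary biproducts. If the monoidal unit object 𝟙 is isomorphic to the biproduct X ⊕ X for some object X of C, then every object of C is a zero object. -/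
open CategoryTheory CategoryTheory.Limits CategoryTheory.MonoidalCategory

/-- Endomorphisms of the unit of a monoidal category commute (Eckmann–Hilton). -/
theorem tensorUnit_end_comp_comm {C : Type*} [Category C] [MonoidalCategory C]
    (f g : 𝟙_ C ⟶ 𝟙_ C) : f ≫ g = g ≫ f := by
  have h := whisker_exchange f g
  rw [id_whiskerLeft, whiskerRight_id, ← unitors_equal, ← unitors_inv_equal] at h
  simpa using h.symm

/-- If the endomorphisms of `X ⊞ X` commute, then `X` is a zero object. -/
theorem isZero_of_biprod_self_end_comp_comm {C : Type*} [Category C] [Preadditive C]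
    [HasBinaryBiproducts C] {X : C} (h : ∀ f g : X ⊞ X ⟶ X ⊞ X, f ≫ g = g ≫ f) :
    IsZero X := by
  rw [IsZero.iff_id_eq_zero]
  have key := h (biprod.fst ≫ biprod.inr) (biprod.snd ≫ biprod.inl)
  simpa using biprod.inl ≫= key =≫ biprod.fst

/-- If the unit of a monoidal preadditive category is a zero object, then so is every object. -/
theorem isZero_of_isZero_tensorUnit {C : Type*} [Category C] [MonoidalCategory C]
    [Preadditive C] [MonoidalPreadditive C] (h : IsZero (𝟙_ C)) (Y : C) : IsZero Y :=
  ((tensorRight Y).map_isZero h).of_iso (λ_ Y).symm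

/-- In a monoidal preadditive category with binary biproducts, if the monoidal unit
is isomorphic to `X ⊞ X` for some object `X`, then every object is a zero object. -/
theorem unit_iso_biprod_self_implies_trivial (C : Type*) [Category C]
    [MonoidalCategory C] [Preadditive C] [MonoidalPreadditive C]
    [HasBinaryBiproducts C] (X : C)
    (h : Nonempty ((𝟙_ C) ≅ X ⊞ X)) :
    ∀ Y : C, IsZero Y := by
  obtain ⟨e⟩ := h
  have hX : IsZero X := isZero_of_biprod_self_end_comp_comm fun f g => by
    simpa using tensorUnit_end_comp_comm (e.hom ≫ f ≫ e.inv) (e.hom ≫ g ≫ e.inv)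
  exact isZero_of_isZero_tensorUnit (((biprod_isZero_iff X X).2 ⟨hX, hX⟩).of_iso e)
end

section
/- Let R be a ring and let f : L → M and g : M → N be degreewise maps of cochain complexes of R-modules commuting with the differentials, such that in every degree f is injective, g is surjective, and ker g = im f. Suppose moreover that the complex L is acyclic in the strong sense that ker d_L = im d_L in every degree. Then in every degree i the induced sequence 0 → im(d_L^{i}) → im(d_M^{i}) → im(d_N^{i}) → 0, with maps given by the restrictions of f and g, is exact: the restriction of f is injective, the restriction of g is surjective, and the kernel of the restriction of g equals the image of the restriction of f. -/
/-- Let `R` be a ring and let `f : L → M`, `g : M → N` be maps of cochain complexes of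
right `R`-modules (encoded as `Rᵐᵒᵖ`-modules), degreewise injective resp. surjective
with `ker g = im f` in every degree.  If `L` is acyclic in the strong sense that
`ker d_L = im d_L` in every degree, then in every degree `i` the induced sequence
`0 → im d_L^i → im d_M^i → im d_N^i → 0`, with maps the restrictions of `f` and `g`,
is exact: the restriction of `f` is injective, the image of `im d_M^i` under `g`
equals `im d_N^i`, and the kernel of the restriction of `g` equals the image of
the restriction of `f`. -/
theorem images_short_exact_of_acyclic_sub (R : Type*) [Ring R]
    (L M N : ℤ → Type*)
    [∀ i, AddCommGroup (L i)] [∀ i, Module Rᵐᵒᵖ (L i)]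
    [∀ i, AddCommGroup (M i)] [∀ i, Module Rᵐᵒᵖ (M i)]
    [∀ i, AddCommGroup (N i)] [∀ i, Module Rᵐᵒᵖ (N i)]
    (dL : ∀ i : ℤ, L i →ₗ[Rᵐᵒᵖ] L (i + 1))
    (dM : ∀ i : ℤ, M i →ₗ[Rᵐᵒᵖ] M (i + 1))
    (dN : ∀ i : ℤ, N i →ₗ[Rᵐᵒᵖ] N (i + 1))
    (hL : ∀ (i : ℤ) (x : L i), dL (i + 1) (dL i x) = 0)
    (hM : ∀ (i : ℤ) (x : M i), dM (i + 1) (dM i x) = 0)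
    (hN : ∀ (i : ℤ) (x : N i), dN (i + 1) (dN i x) = 0)
    (f : ∀ i : ℤ, L i →ₗ[Rᵐᵒᵖ] M i) (g : ∀ i : ℤ, M i →ₗ[Rᵐᵒᵖ] N i)
    (hfd : ∀ (i : ℤ) (x : L i), f (i + 1) (dL i x) = dM i (f i x))
    (hgd : ∀ (i : ℤ) (x : M i), g (i + 1) (dM i x) = dN i (g i x))
    (hfinj : ∀ i, Function.Injective (f i))
    (hgsurj : ∀ i, Function.Surjective (g i))
    (hexact : ∀ i, LinearMap.ker (g i) = LinearMap.range (f i))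
    (hacyclic : ∀ i : ℤ, LinearMap.ker (dL (i + 1)) = LinearMap.range (dL i)) :
    ∀ i : ℤ,
      Set.InjOn (f (i + 1)) (LinearMap.range (dL i) : Set (L (i + 1))) ∧
      Submodule.map (g (i + 1)) (LinearMap.range (dM i)) = LinearMap.range (dN i) ∧
      LinearMap.range (dM i) ⊓ LinearMap.ker (g (i + 1)) =
        Submodule.map (f (i + 1)) (LinearMap.range (dL i)) := by
  intro i
  refine ⟨(hfinj (i + 1)).injOn, ?_, ?_⟩
  · have hcomm : g (i + 1) ∘ₗ dM i = dN i ∘ₗ g i := LinearMap.ext (hgd i)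
    rw [← LinearMap.range_comp, hcomm,
      LinearMap.range_comp_of_range_eq_top _ (LinearMap.range_eq_top.2 (hgsurj i))]
  · apply le_antisymm
    · rintro _ ⟨⟨m, rfl⟩, hm⟩
      rw [hexact] at hm
      obtain ⟨l, hl⟩ := hm
      refine ⟨l, ?_, hl⟩
      rw [← hacyclic, SetLike.mem_coe, LinearMap.mem_ker]
      apply hfinj
      rw [hfd, hl, hM, map_zero]
    · rintro _ ⟨_, ⟨l, rfl⟩, rfl⟩
      refine ⟨⟨f i l, (hfd i l).symm⟩, ?_⟩
      rw [hexact]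
      exact ⟨_, rfl⟩
end
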